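/- arXiv:0804.4311 — 3 statements merged into one kernel-verified Lean document; each statement's English description precedes it below -/
import Mathlib

section
/- (Decoherence Equation) For every real k, every complex z with |z| < 1, every 0 < p ≤ 1 with q = 1 − p, the 2×2 matrix I − Q(k,z) is invertible and P(k,z) = −(q/p)·I + (1/p)·(I − Q(k,z))^{−1}. -/
noncomputable section

open Complex Filter

/-- Amplitude functions on the position × coin space `ℤ × {1,2}`
(coin `0` = "right", coin `1` = "left"). -/
abbrev QState := ℤ × Fin 2 → ℂ

/-- One step of the Hadamard walk: `(hadamardStep ψ) (x,n) = ⟨x,n|U ψ⟩`, where `U = S ∘ C`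
with `S` the chirality-conditioned shift and `C` the Hadamard coin. -/
def hadamardStep (ψ : QState) : QState := fun v =>
  if v.2 = 0 then (ψ (v.1 - 1, 0) + ψ (v.1 - 1, 1)) / (Real.sqrt 2 : ℂ)
  else (ψ (v.1 + 1, 0) - ψ (v.1 + 1, 1)) / (Real.sqrt 2 : ℂ)

/-- The basis state `|x,n⟩`. -/
def ket (x : ℤ) (n : Fin 2) : QState := fun v => if v = (x, n) then 1 else 0

/-- Pure Hadamard-walk probabilities `W_{m,n}(x,t) = |⟨x,n|U^t|0,m⟩|²`. -/
def W (m n : Fin 2) (x : ℤ) (t : ℕ) : ℝ := ‖(hadamardStep^[t] (ket 0 m)) (x, n)‖ ^ 2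

/-- Measurement operators, indexed by `𝔸 = {c} ∪ ℤ×{1,2}`:
`none` is the coherent projection `A_c = √(1-p)·I`, and `some (x,n)` is the
decoherence projection `A_{x,n} = √p |x,n⟩⟨x,n|`. -/
def measOp (p : ℝ) : Option (ℤ × Fin 2) → QState → QState
  | none => fun ψ v => (Real.sqrt (1 - p) : ℂ) * ψ v
  | some w => fun ψ v => if v = w then (Real.sqrt p : ℂ) * ψ w else 0

/-- The amplitude `(A_{j_t}U)⋯(A_{j_1}U)|0,m⟩` along the path `j`. -/
def pathAmp (p : ℝ) (m : Fin 2) : (t : ℕ) → (Fin t → Option (ℤ × Fin 2)) → QState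
  | 0, _ => ket 0 m
  | t + 1, j => measOp p (j (Fin.last t)) (hadamardStep (pathAmp p m t fun i => j i.castSucc))

/-- Decoherent Hadamard-walk probabilities
`P_{m,n}(x,t) = Σ_{j∈𝔸^t} |⟨x,n|(A_{j_t}U)⋯(A_{j_1}U)|0,m⟩|²`. -/
def Pdec (p : ℝ) (m n : Fin 2) (x : ℤ) (t : ℕ) : ℝ :=
  ∑' j : Fin t → Option (ℤ × Fin 2), ‖pathAmp p m t j (x, n)‖ ^ 2

/-- `Ŵ_{m,n}(k,t) = Σ_x W_{m,n}(x,t) e^{ikx}`. -/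
def What (m n : Fin 2) (k : ℝ) (t : ℕ) : ℂ :=
  ∑' x : ℤ, (W m n x t : ℂ) * Complex.exp (Complex.I * k * x)

/-- `P̂_{m,n}(k,z) = Σ_{t≥0} Σ_x P_{m,n}(x,t) e^{ikx} z^t`. -/
def Phat (p : ℝ) (m n : Fin 2) (k : ℝ) (z : ℂ) : ℂ :=
  ∑' t : ℕ, (∑' x : ℤ, (Pdec p m n x t : ℂ) * Complex.exp (Complex.I * k * x)) * z ^ t

/-- `Q̂_{m,n}(k,z) = (p/q) Σ_{t≥1} Ŵ_{m,n}(k,t) (qz)^t = p Σ_{t≥1} Ŵ_{m,n}(k,t) q^{t-1} z^t`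
with `q = 1-p`. -/
def Qhat (p : ℝ) (m n : Fin 2) (k : ℝ) (z : ℂ) : ℂ :=
  (p : ℂ) * ∑' t : ℕ, What m n k (t + 1) * ((1 - p : ℝ) : ℂ) ^ t * z ^ (t + 1)

/-- The matrix `P(k,z) = (P̂_{m,n}(k,z))`. -/
def Pmat (p k : ℝ) (z : ℂ) : Matrix (Fin 2) (Fin 2) ℂ := Matrix.of fun m n => Phat p m n k z

/-- The matrix `Q(k,z) = (Q̂_{m,n}(k,z))`. -/
def Qmat (p k : ℝ) (z : ℂ) : Matrix (Fin 2) (Fin 2) ℂ := Matrix.of fun m n => Qhat p m n k z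

/-- Maximum row-sum norm of a 2×2 complex matrix. -/
def rowSumNorm (A : Matrix (Fin 2) (Fin 2) ℂ) : ℝ :=
  max (‖A 0 0‖ + ‖A 0 1‖) (‖A 1 0‖ + ‖A 1 1‖)

/-- Distribution of the symmetric decoherent Hadamard walk:
`P(X_t = x) = (1/2) Σ_{m,n} P_{m,n}(x,t)`. -/
def PsymProb (p : ℝ) (x : ℤ) (t : ℕ) : ℝ := (1/2) * ∑ m : Fin 2, ∑ n : Fin 2, Pdec p m n x t

/-- Mean position of the symmetric decoherent walk. -/
def symMean (p : ℝ) (t : ℕ) : ℝ := ∑' x : ℤ, (x : ℝ) * PsymProb p x t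

/-- Variance of the symmetric decoherent walk. -/
def symVar (p : ℝ) (t : ℕ) : ℝ :=
  (∑' x : ℤ, (x : ℝ) ^ 2 * PsymProb p x t) - (∑' x : ℤ, (x : ℝ) * PsymProb p x t) ^ 2

/-- The symmetric generating function `P̂(k,z) = (1/2) Σ_{m,n} P̂_{m,n}(k,z)`. -/
def PhatSym (p k : ℝ) (z : ℂ) : ℂ := (1/2) * ∑ m : Fin 2, ∑ n : Fin 2, Phat p m n k z

/-- Characteristic function `P̂(k,t)` of the symmetric decoherent walk. -/
def charSym (p k : ℝ) (t : ℕ) : ℂ :=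
  ∑' x : ℤ, (PsymProb p x t : ℂ) * Complex.exp (Complex.I * k * x)

/-- Distribution of the decoherent walk started at `|0,1⟩`: `P(X̃_t = x) = Σ_n P_{1,n}(x,t)`. -/
def Ptilde (p : ℝ) (x : ℤ) (t : ℕ) : ℝ := ∑ n : Fin 2, Pdec p 0 n x t

/-- Mean position of the decoherent walk started at `|0,1⟩`. -/
def tildeMean (p : ℝ) (t : ℕ) : ℝ := ∑' x : ℤ, (x : ℝ) * Ptilde p x t

/-- Variance of the decoherent walk started at `|0,1⟩`. -/
def tildeVar (p : ℝ) (t : ℕ) : ℝ :=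
  (∑' x : ℤ, (x : ℝ) ^ 2 * Ptilde p x t) - (∑' x : ℤ, (x : ℝ) * Ptilde p x t) ^ 2

/-- Characteristic function of the decoherent walk started at `|0,1⟩`. -/
def charTilde (p k : ℝ) (t : ℕ) : ℂ :=
  ∑' x : ℤ, (Ptilde p x t : ℂ) * Complex.exp (Complex.I * k * x)

/-- The symmetric initial state `φ₀ = (|0,1⟩ + i|0,2⟩)/√2`. -/
def phi0 : QState := fun v =>
  if v = ((0 : ℤ), (0 : Fin 2)) then (1 / Real.sqrt 2 : ℂ)
  else if v = ((0 : ℤ), (1 : Fin 2)) then Complex.I / Real.sqrt 2 else 0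

/-- Distribution of the pure symmetric Hadamard walk: `P(Q_t = x) = Σ_n |⟨x,n|U^t|φ₀⟩|²`. -/
def Ppure (x : ℤ) (t : ℕ) : ℝ := ∑ n : Fin 2, ‖(hadamardStep^[t] phi0) (x, n)‖ ^ 2

/-- Variance of the pure symmetric Hadamard walk. -/
def pureVar (t : ℕ) : ℝ :=
  (∑' x : ℤ, (x : ℝ) ^ 2 * Ppure x t) - (∑' x : ℤ, (x : ℝ) * Ppure x t) ^ 2

/-- `E(k,z) = √((q²z² − (1+cos k)qz + 1)(q²z² + (1+cos k)qz + 1))`, principal branch. -/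
def Efun (q k : ℝ) (z : ℂ) : ℂ :=
  (((q : ℂ) ^ 2 * z ^ 2 - (1 + (Real.cos k : ℂ)) * (q : ℂ) * z + 1) *
    ((q : ℂ) ^ 2 * z ^ 2 + (1 + (Real.cos k : ℂ)) * (q : ℂ) * z + 1)) ^ ((1 : ℂ) / 2)

open scoped ENNReal

/-- Sums over `Option α` split off the value at `none`. -/
theorem ENNReal.tsum_option_eq {α : Type*} (f : Option α → ℝ≥0∞) :
    ∑' a, f a = f none + ∑' a, f (some a) := by
  rw [← (Equiv.optionEquivSumPUnit.{0} α).symm.tsum_eq,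
    Summable.tsum_sum ENNReal.summable ENNReal.summable]
  simp [add_comm]

/-- The squared modulus `|c|²` as an extended nonnegative real. -/
def sqMod (c : ℂ) : ℝ≥0∞ := ENNReal.ofReal (‖c‖ ^ 2)

theorem toReal_sqMod (c : ℂ) : (sqMod c).toReal = ‖c‖ ^ 2 :=
  ENNReal.toReal_ofReal (by positivity)

theorem sqMod_ne_top (c : ℂ) : sqMod c ≠ ∞ := ENNReal.ofReal_ne_top

theorem sqMod_mul (a b : ℂ) : sqMod (a * b) = sqMod a * sqMod b := by
  rw [sqMod, norm_mul, mul_pow, ENNReal.ofReal_mul (by positivity), sqMod, sqMod]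

theorem sqMod_sqrt {r : ℝ} (hr : 0 ≤ r) : sqMod (Real.sqrt r : ℂ) = ENNReal.ofReal r := by
  rw [sqMod, Complex.norm_real, Real.norm_eq_abs, sq_abs, Real.sq_sqrt hr]

theorem sqMod_hadamard (a b : ℂ) :
    sqMod ((a + b) / (Real.sqrt 2 : ℂ)) + sqMod ((a - b) / (Real.sqrt 2 : ℂ)) =
      sqMod a + sqMod b := by
  simp only [sqMod]
  rw [← ENNReal.ofReal_add (by positivity) (by positivity),
    ← ENNReal.ofReal_add (by positivity) (by positivity)]
  congr 1
  have h := parallelogram_law_with_norm ℝ a b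
  have h2 : ‖(Real.sqrt 2 : ℂ)‖ ^ 2 = 2 := by
    rw [Complex.norm_real, Real.norm_eq_abs, sq_abs, Real.sq_sqrt (by norm_num)]
  rw [norm_div, norm_div, div_pow, div_pow, h2]
  linarith

theorem tsum_position_coin (f : ℤ × Fin 2 → ℝ≥0∞) :
    ∑' v, f v = ∑' x, f (x, 0) + ∑' x, f (x, 1) := by
  rw [ENNReal.tsum_prod', ← ENNReal.tsum_add]
  simp [tsum_fintype]

/-- The Hadamard step preserves the total mass. -/
theorem tsum_sqMod_hadamardStep (ψ : QState) :
    ∑' v, sqMod (hadamardStep ψ v) = ∑' v, sqMod (ψ v) := by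
  rw [tsum_position_coin, tsum_position_coin, ← (Equiv.addRight (1 : ℤ)).tsum_eq,
    ← (Equiv.subRight (1 : ℤ)).tsum_eq (fun x => sqMod (hadamardStep ψ (x, 1))),
    ← ENNReal.tsum_add, ← ENNReal.tsum_add]
  refine tsum_congr fun x => ?_
  simpa [hadamardStep] using sqMod_hadamard (ψ (x, 0)) (ψ (x, 1))

theorem tsum_sqMod_iterate_hadamardStep (s : ℕ) (ψ : QState) :
    ∑' v, sqMod (hadamardStep^[s] ψ v) = ∑' v, sqMod (ψ v) := by
  induction s with
  | zero => rfl
  | succ s ih => rw [Function.iterate_succ_apply', tsum_sqMod_hadamardStep, ih]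

theorem tsum_sqMod_ket (y : ℤ) (l : Fin 2) : ∑' v, sqMod (ket y l v) = 1 := by
  rw [tsum_eq_single (y, l) fun v hv => by simp [ket, hv, sqMod]]
  simp [ket, sqMod]

theorem hadamardStep_smul (c : ℂ) (ψ : QState) :
    hadamardStep (c • ψ) = c • hadamardStep ψ := by
  ext v
  simp only [hadamardStep, Pi.smul_apply, smul_eq_mul]
  split_ifs <;> ring

theorem iterate_hadamardStep_smul (s : ℕ) (c : ℂ) (ψ : QState) :
    hadamardStep^[s] (c • ψ) = c • hadamardStep^[s] ψ :=
  (Function.Semiconj.iterate_right (f := (c • ·)) (fun φ => (hadamardStep_smul c φ).symm) s ψ).symm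

/-- Translation covariance of the Hadamard walk. -/
theorem iterate_hadamardStep_ket (s : ℕ) (x y : ℤ) (l n : Fin 2) :
    hadamardStep^[s] (ket y l) (x, n) = hadamardStep^[s] (ket 0 l) (x - y, n) := by
  induction s generalizing x n with
  | zero => simp [ket, sub_eq_zero]
  | succ s ih =>
    simp only [Function.iterate_succ_apply', hadamardStep, ih]
    simp only [sub_right_comm, add_sub_right_comm]

theorem measOp_none (p : ℝ) (ψ : QState) :
    measOp p none ψ = (Real.sqrt (1 - p) : ℂ) • ψ := rfl

theorem measOp_some (p : ℝ) (w : ℤ × Fin 2) (ψ : QState) :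
    measOp p (some w) ψ = ((Real.sqrt p : ℂ) * ψ w) • ket w.1 w.2 := by
  ext v
  simp [measOp, ket]

theorem pathAmp_snoc (p : ℝ) (m : Fin 2) (t : ℕ) (j : Fin t → Option (ℤ × Fin 2))
    (a : Option (ℤ × Fin 2)) :
    pathAmp p m (t + 1) (Fin.snoc (α := fun _ => Option (ℤ × Fin 2)) j a) =
      measOp p a (hadamardStep (pathAmp p m t j)) := by
  simp [pathAmp]

/-- The probability that the walk which decoheres during its first `t` steps and then evolves
unitarily for `s` further steps ends at `v`. -/
def mixedProb (p : ℝ) (m : Fin 2) (t s : ℕ) (v : ℤ × Fin 2) : ℝ≥0∞ :=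
  ∑' j : Fin t → Option (ℤ × Fin 2), sqMod (hadamardStep^[s] (pathAmp p m t j) v)

theorem mixedProb_zero_left (p : ℝ) (m : Fin 2) (s : ℕ) (v : ℤ × Fin 2) :
    mixedProb p m 0 s v = sqMod (hadamardStep^[s] (ket 0 m) v) := by
  simp [mixedProb, tsum_fintype, pathAmp]

theorem mixedProb_succ {p : ℝ} (hp0 : 0 ≤ p) (hp1 : p ≤ 1) (m : Fin 2) (t s : ℕ)
    (v : ℤ × Fin 2) :
    mixedProb p m (t + 1) s v =
      ENNReal.ofReal (1 - p) * mixedProb p m t (s + 1) v +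
        ENNReal.ofReal p *
          ∑' w, mixedProb p m t 1 w * sqMod (hadamardStep^[s] (ket w.1 w.2) v) := by
  rw [mixedProb, ← (Fin.snocEquiv fun _ : Fin (t + 1) => Option (ℤ × Fin 2)).tsum_eq,
    ENNReal.tsum_prod', ENNReal.tsum_option_eq]
  congr 1
  · rw [mixedProb, ← ENNReal.tsum_mul_left]
    refine tsum_congr fun j => ?_
    simp only [Fin.snocEquiv, Equiv.coe_fn_mk]
    rw [pathAmp_snoc, measOp_none, iterate_hadamardStep_smul, Pi.smul_apply, smul_eq_mul,
      sqMod_mul, sqMod_sqrt (sub_nonneg.2 hp1), Function.iterate_succ_apply]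
  · rw [← ENNReal.tsum_mul_left]
    refine tsum_congr fun w => ?_
    rw [mixedProb, ← ENNReal.tsum_mul_right, ← ENNReal.tsum_mul_left]
    refine tsum_congr fun j => ?_
    simp only [Fin.snocEquiv, Equiv.coe_fn_mk]
    rw [pathAmp_snoc, measOp_some, iterate_hadamardStep_smul, Pi.smul_apply, smul_eq_mul,
      sqMod_mul, sqMod_mul, sqMod_sqrt hp0, mul_assoc, Function.iterate_one]

theorem tsum_mixedProb {p : ℝ} (hp0 : 0 ≤ p) (hp1 : p ≤ 1) (m : Fin 2) (t s : ℕ) :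
    ∑' v, mixedProb p m t s v = 1 := by
  induction t generalizing s with
  | zero =>
    simp only [mixedProb_zero_left]
    rw [tsum_sqMod_iterate_hadamardStep, tsum_sqMod_ket]
  | succ t ih =>
    simp only [mixedProb_succ hp0 hp1]
    rw [ENNReal.tsum_add, ENNReal.tsum_mul_left, ENNReal.tsum_mul_left, ENNReal.tsum_comm]
    simp only [ENNReal.tsum_mul_left, tsum_sqMod_iterate_hadamardStep, tsum_sqMod_ket, ih,
      mul_one]
    rw [← ENNReal.ofReal_add (sub_nonneg.2 hp1) hp0]
    simp

theorem tsum_position_mixedProb_le {p : ℝ} (hp0 : 0 ≤ p) (hp1 : p ≤ 1) (m n : Fin 2)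
    (t s : ℕ) : ∑' x, mixedProb p m t s (x, n) ≤ 1 := by
  rw [← tsum_mixedProb hp0 hp1 m t s]
  exact ENNReal.tsum_comp_le_tsum_of_injective (Prod.mk_left_injective n) _

theorem Pdec_eq (p : ℝ) (m n : Fin 2) (x : ℤ) (t : ℕ) :
    Pdec p m n x t = (mixedProb p m t 0 (x, n)).toReal := by
  rw [mixedProb, ENNReal.tsum_toReal_eq fun _ => sqMod_ne_top _]
  simp [toReal_sqMod, Pdec]

theorem W_eq (p : ℝ) (m n : Fin 2) (x : ℤ) (t : ℕ) :
    W m n x t = (mixedProb p m 0 t (x, n)).toReal := by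
  rw [mixedProb_zero_left, toReal_sqMod, W]

/-- Convolution of two functions on the integers. -/
def intConv (f g : ℤ → ℝ≥0∞) (x : ℤ) : ℝ≥0∞ := ∑' y, f y * g (x - y)

theorem mixedProb_succ_eq_intConv {p : ℝ} (hp0 : 0 ≤ p) (hp1 : p ≤ 1) (m n : Fin 2)
    (t s : ℕ) (x : ℤ) :
    mixedProb p m (t + 1) s (x, n) =
      ENNReal.ofReal (1 - p) * mixedProb p m t (s + 1) (x, n) +
        ENNReal.ofReal p * ∑ l,
          intConv (fun y => mixedProb p m t 1 (y, l)) (fun y => mixedProb p l 0 s (y, n)) x := by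
  simp only [mixedProb_succ hp0 hp1, tsum_position_coin, intConv, mixedProb_zero_left,
    iterate_hadamardStep_ket s x, Fin.sum_univ_two]

/-- The Fourier transform of a nonnegative function on the integers. -/
def intFourier (k : ℝ) (f : ℤ → ℝ≥0∞) : ℂ :=
  ∑' x : ℤ, ((f x).toReal : ℂ) * Complex.exp (Complex.I * k * x)

theorem norm_exp_I_mul_mul (k : ℝ) (x : ℤ) : ‖Complex.exp (Complex.I * k * x)‖ = 1 := by
  have h : Complex.I * k * x = ((k * x : ℝ) : ℂ) * Complex.I := by push_cast; ring
  rw [h, Complex.norm_exp_ofReal_mul_I]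

theorem norm_intFourier_term (k : ℝ) (f : ℤ → ℝ≥0∞) (x : ℤ) :
    ‖((f x).toReal : ℂ) * Complex.exp (Complex.I * k * x)‖ = (f x).toReal := by
  rw [norm_mul, norm_exp_I_mul_mul, mul_one, Complex.norm_real, Real.norm_eq_abs,
    abs_of_nonneg ENNReal.toReal_nonneg]

theorem summable_norm_intFourier_term (k : ℝ) {f : ℤ → ℝ≥0∞} (hf : ∑' x, f x ≠ ∞) :
    Summable fun x => ‖((f x).toReal : ℂ) * Complex.exp (Complex.I * k * x)‖ := by
  simpa only [norm_intFourier_term] using ENNReal.summable_toReal hf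

theorem norm_intFourier_le (k : ℝ) {f : ℤ → ℝ≥0∞} (hf : ∑' x, f x ≠ ∞) :
    ‖intFourier k f‖ ≤ (∑' x, f x).toReal := by
  refine (norm_tsum_le_tsum_norm (summable_norm_intFourier_term k hf)).trans_eq ?_
  simp only [norm_intFourier_term]
  rw [ENNReal.tsum_toReal_eq (ENNReal.ne_top_of_tsum_ne_top hf)]

theorem intFourier_add (k : ℝ) {f g : ℤ → ℝ≥0∞} (hf : ∑' x, f x ≠ ∞) (hg : ∑' x, g x ≠ ∞) :
    intFourier k (fun x => f x + g x) = intFourier k f + intFourier k g := by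
  rw [intFourier, intFourier, intFourier, ← Summable.tsum_add
    (summable_norm_intFourier_term k hf).of_norm (summable_norm_intFourier_term k hg).of_norm]
  refine tsum_congr fun x => ?_
  rw [ENNReal.toReal_add (ENNReal.ne_top_of_tsum_ne_top hf x)
    (ENNReal.ne_top_of_tsum_ne_top hg x)]
  push_cast
  ring

theorem intFourier_ofReal_mul (k : ℝ) {c : ℝ} (hc : 0 ≤ c) (f : ℤ → ℝ≥0∞) :
    intFourier k (fun x => ENNReal.ofReal c * f x) = c * intFourier k f := by
  rw [intFourier, intFourier, ← tsum_mul_left]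
  refine tsum_congr fun x => ?_
  rw [ENNReal.toReal_mul, ENNReal.toReal_ofReal hc]
  push_cast
  ring

theorem tsum_intConv (f g : ℤ → ℝ≥0∞) :
    ∑' x, intConv f g x = (∑' x, f x) * ∑' x, g x := by
  simp only [intConv]
  rw [ENNReal.tsum_comm, ← ENNReal.tsum_mul_right]
  refine tsum_congr fun y => ?_
  rw [ENNReal.tsum_mul_left, ← (Equiv.subRight y).tsum_eq g]
  rfl

theorem intFourier_intConv (k : ℝ) {f g : ℤ → ℝ≥0∞} (hf : ∑' x, f x ≠ ∞)
    (hg : ∑' x, g x ≠ ∞) :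
    intFourier k (intConv f g) = intFourier k f * intFourier k g := by
  have hfs := summable_norm_intFourier_term k hf
  have hgs := summable_norm_intFourier_term k hg
  let e : ℤ × ℤ ≃ ℤ × ℤ :=
    { toFun := fun v => (v.2, v.1 - v.2)
      invFun := fun v => (v.1 + v.2, v.1)
      left_inv := fun v => by simp
      right_inv := fun v => by simp }
  have hs := e.summable_iff.2 (summable_mul_of_summable_norm hfs hgs)
  rw [intFourier, intFourier, intFourier, tsum_mul_tsum_of_summable_norm hfs hgs, ← e.tsum_eq]
  refine Eq.trans (tsum_congr fun x => ?_) hs.tsum_prod.symm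
  rw [intConv, ENNReal.tsum_toReal_eq fun y => ENNReal.mul_ne_top
    (ENNReal.ne_top_of_tsum_ne_top hf _) (ENNReal.ne_top_of_tsum_ne_top hg _),
    Complex.ofReal_tsum, ← tsum_mul_right]
  refine tsum_congr fun y => ?_
  have h : Complex.exp (Complex.I * k * x) =
      Complex.exp (Complex.I * k * y) * Complex.exp (Complex.I * k * (x - y : ℤ)) := by
    rw [← Complex.exp_add]
    push_cast
    ring_nf
  simp only [Function.comp, e, Equiv.coe_fn_mk, h, ENNReal.toReal_mul]
  push_cast
  ring

/-- The matrix of Fourier transforms of `mixedProb`. -/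
def mixedMat (p k : ℝ) (t s : ℕ) : Matrix (Fin 2) (Fin 2) ℂ :=
  Matrix.of fun m n => intFourier k fun x => mixedProb p m t s (x, n)

theorem What_eq (p k : ℝ) (m n : Fin 2) (t : ℕ) : What m n k t = mixedMat p k 0 t m n := by
  simp [What, mixedMat, intFourier, W_eq p]

theorem Phat_eq (p k : ℝ) (m n : Fin 2) (z : ℂ) :
    Phat p m n k z = ∑' t, mixedMat p k t 0 m n * z ^ t := by
  simp [Phat, mixedMat, intFourier, Pdec_eq]

theorem mixedMat_zero_zero (p k : ℝ) : mixedMat p k 0 0 = 1 := by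
  ext m n
  simp only [mixedMat, Matrix.of_apply, intFourier, mixedProb_zero_left, toReal_sqMod]
  rw [tsum_eq_single 0 fun x hx => by simp [ket, hx]]
  obtain rfl | h := eq_or_ne m n
  · simp [ket]
  · simp [ket, h, h.symm]

theorem norm_mixedMat_le {p : ℝ} (hp0 : 0 ≤ p) (hp1 : p ≤ 1) (k : ℝ) (t s : ℕ)
    (m n : Fin 2) : ‖mixedMat p k t s m n‖ ≤ 1 := by
  have h := tsum_position_mixedProb_le hp0 hp1 m n t s
  refine (norm_intFourier_le k (ne_top_of_le_ne_top ENNReal.one_ne_top h)).trans ?_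
  exact ENNReal.toReal_le_of_le_ofReal zero_le_one (by simpa using h)

theorem mixedMat_succ {p : ℝ} (hp0 : 0 ≤ p) (hp1 : p ≤ 1) (k : ℝ) (t s : ℕ) :
    mixedMat p k (t + 1) s = ((1 - p : ℝ) : ℂ) • mixedMat p k t (s + 1) +
      (p : ℂ) • (mixedMat p k t 1 * mixedMat p k 0 s) := by
  ext m n
  have hfin (m n : Fin 2) (t s : ℕ) : ∑' x, mixedProb p m t s (x, n) ≠ ∞ :=
    ne_top_of_le_ne_top ENNReal.one_ne_top (tsum_position_mixedProb_le hp0 hp1 m n t s)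
  have hconv (l : Fin 2) : ∑' x, intConv (fun y => mixedProb p m t 1 (y, l))
      (fun y => mixedProb p l 0 s (y, n)) x ≠ ∞ := by
    rw [tsum_intConv]
    exact ENNReal.mul_ne_top (hfin _ _ _ _) (hfin _ _ _ _)
  have hsum : ∑' x, ∑ l, intConv (fun y => mixedProb p m t 1 (y, l))
      (fun y => mixedProb p l 0 s (y, n)) x ≠ ∞ := by
    simp only [Fin.sum_univ_two, ENNReal.tsum_add]
    exact ENNReal.add_ne_top.2 ⟨hconv 0, hconv 1⟩
  simp only [mixedMat, Matrix.of_apply, Matrix.add_apply, Matrix.smul_apply, smul_eq_mul,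
    Matrix.mul_apply, mixedProb_succ_eq_intConv hp0 hp1]
  rw [intFourier_add k, intFourier_ofReal_mul k (sub_nonneg.2 hp1), intFourier_ofReal_mul k hp0]
  · simp only [Fin.sum_univ_two]
    rw [intFourier_add k (hconv 0) (hconv 1),
      intFourier_intConv k (hfin _ _ _ _) (hfin _ _ _ _),
      intFourier_intConv k (hfin _ _ _ _) (hfin _ _ _ _)]
  · rw [ENNReal.tsum_mul_left]
    exact ENNReal.mul_ne_top ENNReal.ofReal_ne_top (hfin _ _ _ _)
  · rw [ENNReal.tsum_mul_left]
    exact ENNReal.mul_ne_top ENNReal.ofReal_ne_top hsum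

theorem mixedMat_succ_zero {p : ℝ} (hp0 : 0 ≤ p) (hp1 : p ≤ 1) (k : ℝ) (t : ℕ) :
    mixedMat p k (t + 1) 0 = mixedMat p k t 1 := by
  rw [mixedMat_succ hp0 hp1, mixedMat_zero_zero, mul_one, ← add_smul]
  simp

/-- Renewal equation, decomposing according to the time of the last measurement. -/
theorem mixedMat_renewal {p : ℝ} (hp0 : 0 ≤ p) (hp1 : p ≤ 1) (k : ℝ) (t s : ℕ) :
    mixedMat p k t (s + 1) = ((1 - p : ℝ) : ℂ) ^ (t + 1) • mixedMat p k 0 (t + s + 1) +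
      (p : ℂ) • ∑ ij ∈ Finset.HasAntidiagonal.antidiagonal t, ((1 - p : ℝ) : ℂ) ^ ij.2 •
        (mixedMat p k ij.1 0 * mixedMat p k 0 (ij.2 + s + 1)) := by
  induction t generalizing s with
  | zero =>
    simp only [Finset.Nat.antidiagonal_zero, Finset.sum_singleton, mixedMat_zero_zero, one_mul,
      zero_add, pow_zero, one_smul, pow_one, ← add_smul]
    simp
  | succ t ih =>
    rw [mixedMat_succ hp0 hp1, ih (s + 1), Finset.Nat.sum_antidiagonal_succ',
      mixedMat_succ_zero hp0 hp1, smul_add, smul_smul, ← pow_succ', smul_comm _ (p : ℂ),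
      Finset.smul_sum]
    simp only [smul_smul, ← pow_succ', pow_zero, one_smul, smul_add, zero_add]
    rw [add_assoc, add_comm ((p : ℂ) • (mixedMat p k t 1 * mixedMat p k 0 (s + 1)))]
    simp only [add_left_comm, add_comm]

theorem Pmat_eq_one_add {p : ℝ} (hp0 : 0 < p) (hp1 : p ≤ 1) (k : ℝ) {z : ℂ} (hz : ‖z‖ < 1) :
    Pmat p k z = 1 + (((1 - p) / p : ℝ) : ℂ) • Qmat p k z + Pmat p k z * Qmat p k z := by
  have hgeo : Summable fun t : ℕ => ‖z‖ ^ t := summable_geometric_of_lt_one (norm_nonneg _) hz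
  have hP (m n : Fin 2) : Summable fun t => ‖mixedMat p k t 0 m n * z ^ t‖ := by
    refine hgeo.of_nonneg_of_le (fun t => norm_nonneg _) fun t => ?_
    rw [norm_mul, norm_pow]
    exact mul_le_of_le_one_left (by positivity) (norm_mixedMat_le hp0.le hp1 k t 0 m n)
  have hQ (m n : Fin 2) : Summable fun t =>
      ‖mixedMat p k 0 (t + 1) m n * ((1 - p : ℝ) : ℂ) ^ t * z ^ (t + 1)‖ := by
    refine ((summable_nat_add_iff 1).2 hgeo).of_nonneg_of_le (fun t => norm_nonneg _) fun t => ?_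
    rw [norm_mul, norm_mul, norm_pow, norm_pow, Complex.norm_real,
      Real.norm_of_nonneg (sub_nonneg.2 hp1)]
    refine mul_le_of_le_one_left (by positivity) ?_
    exact mul_le_one₀ (norm_mixedMat_le hp0.le hp1 k 0 _ m n)
      (pow_nonneg (sub_nonneg.2 hp1) _) (pow_le_one₀ (sub_nonneg.2 hp1) (by linarith))
  have hPQ (m l n : Fin 2) := tsum_mul_tsum_eq_tsum_sum_antidiagonal_of_summable_norm
    (hP m l) (hQ l n)
  have hPQs (m l n : Fin 2) := (summable_norm_sum_mul_antidiagonal_of_summable_norm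
    (hP m l) (hQ l n)).of_norm
  ext m n
  simp only [Matrix.add_apply, Matrix.smul_apply, Matrix.mul_apply, Pmat, Qmat, Matrix.of_apply,
    Fin.sum_univ_two, Phat_eq, Qhat, What_eq p, smul_eq_mul]
  rw [(hP m n).of_norm.tsum_eq_zero_add, mul_left_comm (∑' t, mixedMat p k t 0 m 0 * z ^ t),
    mul_left_comm (∑' t, mixedMat p k t 0 m 1 * z ^ t), hPQ, hPQ, ← mul_add,
    ← (hPQs m 0 n).tsum_add (hPQs m 1 n), ← mul_assoc, ← tsum_mul_left, ← tsum_mul_left,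
    add_assoc, ← ((hQ m n).of_norm.mul_left _).tsum_add
      (((hPQs m 0 n).add (hPQs m 1 n)).mul_left _)]
  congr 1
  · simp [mixedMat_zero_zero]
  refine tsum_congr fun t => ?_
  have hc : (((1 - p) / p : ℝ) : ℂ) * (p : ℂ) = ((1 - p : ℝ) : ℂ) := by
    rw [← Complex.ofReal_mul, div_mul_cancel₀ _ hp0.ne']
  rw [mixedMat_succ_zero hp0.le hp1, mixedMat_renewal hp0.le hp1 k t 0, hc,
    ← Finset.sum_add_distrib, Matrix.add_apply, Matrix.smul_apply, Matrix.smul_apply,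
    Matrix.sum_apply, add_mul, smul_eq_mul, smul_eq_mul, mul_assoc (p : ℂ), Finset.sum_mul]
  congr 1
  · simp only [add_zero]
    ring
  · congr 1
    refine Finset.sum_congr rfl fun ij hij => ?_
    rw [← Finset.HasAntidiagonal.mem_antidiagonal.1 hij]
    simp only [Matrix.smul_apply, Matrix.mul_apply, Fin.sum_univ_two, smul_eq_mul, add_zero]
    ring

/-- **The Decoherence Equation.** For every real `k`, every `0 < p ≤ 1` with `q = 1 - p`,
and every complex `z` with `|z| < 1`, the matrix `I - Q(k,z)` is invertible and
`P(k,z) = -(q/p)·I + (1/p)·(I - Q(k,z))⁻¹`. -/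
theorem decoherence_equation (k p q : ℝ) (hp0 : 0 < p) (hp1 : p ≤ 1) (hq : q = 1 - p)
    (z : ℂ) (hz : ‖z‖ < 1) :
    IsUnit (1 - Qmat p k z) ∧
    Pmat p k z = -(((q / p : ℝ) : ℂ)) • (1 : Matrix (Fin 2) (Fin 2) ℂ)
      + ((1 / p : ℝ) : ℂ) • (1 - Qmat p k z)⁻¹ := by
  subst hq
  have hp : (p : ℂ) ≠ 0 := Complex.ofReal_ne_zero.2 hp0.ne'
  have key : ((p : ℂ) • Pmat p k z + ((1 - p : ℝ) : ℂ) • 1) * (1 - Qmat p k z) = 1 := by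
    have h : Pmat p k z * (1 - Qmat p k z) = 1 + (((1 - p) / p : ℝ) : ℂ) • Qmat p k z := by
      rw [mul_sub, mul_one, sub_eq_iff_eq_add]
      exact Pmat_eq_one_add hp0 hp1 k hz
    rw [add_mul, smul_mul_assoc, smul_mul_assoc, one_mul, h, smul_add, smul_smul, smul_sub]
    have hc : (p : ℂ) * (((1 - p) / p : ℝ) : ℂ) = ((1 - p : ℝ) : ℂ) := by
      rw [← Complex.ofReal_mul, mul_div_cancel₀ _ hp0.ne']
    rw [hc, add_add_sub_cancel, ← add_smul]
    simp
  refine ⟨IsUnit.of_mul_eq_one_right _ key, ?_⟩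
  rw [Matrix.inv_eq_left_inv key, smul_add, smul_smul, smul_smul]
  have h1 : ((1 / p : ℝ) : ℂ) * (p : ℂ) = 1 := by
    push_cast
    field_simp
  have h2 : ((1 / p : ℝ) : ℂ) * ((1 - p : ℝ) : ℂ) = (((1 - p) / p : ℝ) : ℂ) := by
    push_cast
    field_simp
  rw [h1, h2, one_smul, neg_smul]
  abel

end
end

section
/- For every 0 < p ≤ 1 with q = 1 − p, all m, n ∈ {1,2}, every x ∈ ℤ, and every integer t ≥ 1, the decoherent Hadamard walk probabilities satisfy the renewal equation P_{m,n}(x,t) = Σ_{s=1}^{t−1} p q^{s−1} Σ_{y∈ℤ} Σ_{l∈{1,2}} W_{l,n}(x−y, s) P_{m,l}(y, t−s) + q^{t−1} W_{m,n}(x,t). -/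
noncomputable section

open Complex Filter

open scoped ENNReal

theorem hadamardStep_iterate_smul (k : ℕ) (c : ℂ) (ψ : QState) :
    hadamardStep^[k] (c • ψ) = c • hadamardStep^[k] ψ := by
  induction k generalizing ψ with
  | zero => rfl
  | succ k ih => rw [Function.iterate_succ_apply, hadamardStep_smul, ih, Function.iterate_succ_apply]

theorem hadamardStep_iterate_ket_apply (k : ℕ) (y : ℤ) (l : Fin 2) (x : ℤ) (n : Fin 2) :
    hadamardStep^[k] (ket y l) (x, n) = hadamardStep^[k] (ket 0 l) (x - y, n) := by
  induction k generalizing x n with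
  | zero => simp [ket, sub_eq_zero]
  | succ k ih =>
    simp only [Function.iterate_succ_apply', hadamardStep, ih]
    simp only [sub_right_comm, sub_add_eq_add_sub]

theorem hadamardStep_iterate_ket_eq_zero {k : ℕ} {w v : ℤ × Fin 2}
    (h : (k : ℤ) < |v.1 - w.1|) : hadamardStep^[k] (ket w.1 w.2) v = 0 := by
  induction k generalizing v with
  | zero =>
    have hne : v ≠ w := by rintro rfl; simp at h
    simp [ket, hne]
  | succ k ih =>
    rw [lt_abs] at h
    push_cast at h
    have h₁ (i : Fin 2) : hadamardStep^[k] (ket w.1 w.2) (v.1 - 1, i) = 0 :=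
      ih (lt_abs.2 (by dsimp only; omega))
    have h₂ (i : Fin 2) : hadamardStep^[k] (ket w.1 w.2) (v.1 + 1, i) = 0 :=
      ih (lt_abs.2 (by dsimp only; omega))
    simp [Function.iterate_succ_apply', hadamardStep, h₁, h₂]

theorem finite_support_hadamardStep_iterate_ket (k : ℕ) (v : ℤ × Fin 2) :
    (Function.support fun w : ℤ × Fin 2 => hadamardStep^[k] (ket w.1 w.2) v).Finite := by
  refine ((Set.finite_Icc (v.1 - k) (v.1 + k)).prod Set.finite_univ).subset fun w hw => ?_
  have h : |v.1 - w.1| ≤ k := not_lt.1 fun h => hw (hadamardStep_iterate_ket_eq_zero h)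
  simp only [Set.mem_prod, Set.mem_Icc, Set.mem_univ, and_true]
  grind

theorem enorm_ofReal_sqrt_sq {a : ℝ} (ha : 0 ≤ a) :
    ‖(Real.sqrt a : ℂ)‖ₑ ^ 2 = ENNReal.ofReal a := by
  rw [← ofReal_norm, ← ENNReal.ofReal_pow (norm_nonneg _), Complex.norm_real,
    Real.norm_eq_abs, sq_abs, Real.sq_sqrt ha]

/-- The total squared amplitude at `v`, over all measurement records of length `t`, after `k`
further coherent steps. -/
def pathMass (p : ℝ) (m : Fin 2) (t k : ℕ) (v : ℤ × Fin 2) : ℝ≥0∞ :=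
  ∑' j : Fin t → Option (ℤ × Fin 2), ‖hadamardStep^[k] (pathAmp p m t j) v‖ₑ ^ 2

theorem pathMass_zero (p : ℝ) (m : Fin 2) (k : ℕ) (v : ℤ × Fin 2) :
    pathMass p m 0 k v = ‖hadamardStep^[k] (ket 0 m) v‖ₑ ^ 2 := by
  simp [pathMass, pathAmp, tsum_fintype]

theorem tsum_enorm_measOp_sq {p : ℝ} (hp0 : 0 ≤ p) (hp1 : p ≤ 1) (k : ℕ) (ψ : QState)
    (v : ℤ × Fin 2) :
    ∑' a, ‖hadamardStep^[k] (measOp p a ψ) v‖ₑ ^ 2 =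
      ENNReal.ofReal (1 - p) * ‖hadamardStep^[k] ψ v‖ₑ ^ 2 + ENNReal.ofReal p *
        ∑' w : ℤ × Fin 2, ‖hadamardStep^[k] (ket w.1 w.2) v‖ₑ ^ 2 * ‖ψ w‖ₑ ^ 2 := by
  rw [← (Equiv.optionEquivSumPUnit.{0} (ℤ × Fin 2)).symm.tsum_eq,
    Summable.tsum_sum ENNReal.summable ENNReal.summable, add_comm, ← ENNReal.tsum_mul_left]
  simp only [tsum_fintype, Finset.univ_unique, Finset.sum_singleton,
    Equiv.optionEquivSumPUnit_symm_inl, Equiv.optionEquivSumPUnit_symm_inr, measOp_none,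
    measOp_some, hadamardStep_iterate_smul, Pi.smul_apply, smul_eq_mul, enorm_mul, mul_pow,
    enorm_ofReal_sqrt_sq hp0, enorm_ofReal_sqrt_sq (sub_nonneg.2 hp1)]
  congr 1
  exact tsum_congr fun w => by ring

theorem pathMass_succ {p : ℝ} (hp0 : 0 ≤ p) (hp1 : p ≤ 1) (m : Fin 2) (t k : ℕ)
    (v : ℤ × Fin 2) :
    pathMass p m (t + 1) k v =
      ENNReal.ofReal (1 - p) * pathMass p m t (k + 1) v + ENNReal.ofReal p *
        ∑' w : ℤ × Fin 2, ‖hadamardStep^[k] (ket w.1 w.2) v‖ₑ ^ 2 * pathMass p m t 1 w := by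
  have hsnoc (a : Option (ℤ × Fin 2)) (j : Fin t → Option (ℤ × Fin 2)) :
      pathAmp p m (t + 1) (Fin.snocEquiv (fun _ => Option (ℤ × Fin 2)) (a, j)) =
        measOp p a (hadamardStep (pathAmp p m t j)) := by
    simp [pathAmp, Fin.snocEquiv]
  simp only [pathMass, ← ENNReal.tsum_mul_left]
  rw [ENNReal.tsum_comm, ← ENNReal.tsum_add,
    ← (Fin.snocEquiv fun _ : Fin (t + 1) => Option (ℤ × Fin 2)).tsum_eq, ENNReal.tsum_prod',
    ENNReal.tsum_comm]
  refine tsum_congr fun j => ?_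
  simp only [hsnoc, tsum_enorm_measOp_sq hp0 hp1, ENNReal.tsum_mul_left,
    Function.iterate_succ_apply, Function.iterate_zero, id]

theorem pathMass_succ_zero {p : ℝ} (hp0 : 0 ≤ p) (hp1 : p ≤ 1) (m : Fin 2) (t : ℕ)
    (v : ℤ × Fin 2) : pathMass p m (t + 1) 0 v = pathMass p m t 1 v := by
  rw [pathMass_succ hp0 hp1, tsum_eq_single v]
  · simp only [Function.iterate_zero, id, ket, if_true, enorm_one, one_pow, one_mul, zero_add,
      ← add_mul, ← ENNReal.ofReal_add (sub_nonneg.2 hp1) hp0, sub_add_cancel, ENNReal.ofReal_one]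
  · intro w hw
    simp [ket, hw.symm]

theorem pathMass_ne_top {p : ℝ} (hp0 : 0 ≤ p) (hp1 : p ≤ 1) (m : Fin 2) (t k : ℕ)
    (v : ℤ × Fin 2) : pathMass p m t k v ≠ ⊤ := by
  induction t generalizing k v with
  | zero => simp [pathMass_zero]
  | succ t ih =>
    rw [pathMass_succ hp0 hp1, tsum_eq_sum
      (s := (finite_support_hadamardStep_iterate_ket k v).toFinset)]
    · refine ENNReal.add_ne_top.2 ⟨ENNReal.mul_ne_top ENNReal.ofReal_ne_top (ih _ _),
        ENNReal.mul_ne_top ENNReal.ofReal_ne_top (ENNReal.sum_ne_top.2 fun w _ => ?_)⟩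
      exact ENNReal.mul_ne_top (ENNReal.pow_ne_top enorm_ne_top) (ih _ _)
    · intro w hw
      simp only [Set.Finite.mem_toFinset, Function.mem_support, not_not] at hw
      simp [hw]

theorem pathMass_renewal {p : ℝ} (hp0 : 0 ≤ p) (hp1 : p ≤ 1) (m : Fin 2) (t k : ℕ)
    (v : ℤ × Fin 2) :
    pathMass p m t k v =
      (∑ i ∈ Finset.range t, ENNReal.ofReal p * ENNReal.ofReal (1 - p) ^ i *
        ∑' w : ℤ × Fin 2, ‖hadamardStep^[k + i] (ket w.1 w.2) v‖ₑ ^ 2 *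
          pathMass p m (t - i) 0 w) +
      ENNReal.ofReal (1 - p) ^ t * ‖hadamardStep^[k + t] (ket 0 m) v‖ₑ ^ 2 := by
  induction t generalizing k with
  | zero => simp [pathMass_zero]
  | succ t ih =>
    rw [pathMass_succ hp0 hp1, ih, Finset.sum_range_succ', mul_add, Finset.mul_sum]
    simp only [Nat.add_sub_add_right, Nat.sub_zero, pathMass_succ_zero hp0 hp1, add_zero,
      pow_zero, mul_one, pow_succ', add_right_comm k 1, ← add_assoc]
    rw [add_right_comm, mul_assoc (ENNReal.ofReal (1 - p))]
    congr 2
    exact Finset.sum_congr rfl fun i _ => by ring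

theorem toReal_enorm_sq (z : ℂ) : (‖z‖ₑ ^ 2).toReal = ‖z‖ ^ 2 := by
  rw [ENNReal.toReal_pow, toReal_enorm]

theorem toReal_pathMass_zero (p : ℝ) (m n : Fin 2) (x : ℤ) (t : ℕ) :
    (pathMass p m t 0 (x, n)).toReal = Pdec p m n x t := by
  rw [pathMass, ENNReal.tsum_toReal_eq fun j => ENNReal.pow_ne_top enorm_ne_top]
  simp only [toReal_enorm_sq, Function.iterate_zero, id, Pdec]

theorem tsum_ket_mul_pathMass_eq {p : ℝ} (m n : Fin 2) (x : ℤ) (t s : ℕ) :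
    ∑' w : ℤ × Fin 2, ‖hadamardStep^[s] (ket w.1 w.2) (x, n)‖ₑ ^ 2 * pathMass p m t 0 w =
      ∑' y : ℤ, ∑ l : Fin 2,
        ‖hadamardStep^[s] (ket y l) (x, n)‖ₑ ^ 2 * pathMass p m t 0 (y, l) := by
  rw [ENNReal.tsum_prod']
  simp only [tsum_fintype]

theorem toReal_tsum_ket_mul_pathMass {p : ℝ} (hp0 : 0 ≤ p) (hp1 : p ≤ 1) (m n : Fin 2)
    (x : ℤ) (t s : ℕ) :
    (∑' w : ℤ × Fin 2,
        ‖hadamardStep^[s] (ket w.1 w.2) (x, n)‖ₑ ^ 2 * pathMass p m t 0 w).toReal =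
      ∑' y : ℤ, ∑ l : Fin 2, W l n (x - y) s * Pdec p m l y t := by
  have hne (y : ℤ) (l : Fin 2) :
      ‖hadamardStep^[s] (ket y l) (x, n)‖ₑ ^ 2 * pathMass p m t 0 (y, l) ≠ ⊤ :=
    ENNReal.mul_ne_top (ENNReal.pow_ne_top enorm_ne_top) (pathMass_ne_top hp0 hp1 m t 0 (y, l))
  rw [tsum_ket_mul_pathMass_eq,
    ENNReal.tsum_toReal_eq fun y => ENNReal.sum_ne_top.2 fun l _ => hne y l]
  refine tsum_congr fun y => ?_
  rw [ENNReal.toReal_sum fun l _ => hne y l]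
  simp only [ENNReal.toReal_mul, toReal_enorm_sq, toReal_pathMass_zero, W,
    hadamardStep_iterate_ket_apply s y]

/-- The renewal equation for the decoherent Hadamard walk probabilities: for `t ≥ 1`,
`P_{m,n}(x,t) = Σ_{s=1}^{t-1} p q^{s-1} Σ_{y,l} W_{l,n}(x-y,s) P_{m,l}(y,t-s)
 + q^{t-1} W_{m,n}(x,t)`. -/
theorem renewal_equation (p q : ℝ) (hp0 : 0 < p) (hp1 : p ≤ 1) (hq : q = 1 - p)
    (m n : Fin 2) (x : ℤ) (t : ℕ) (ht : 1 ≤ t) :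
    Pdec p m n x t =
      (∑ s ∈ Finset.Icc 1 (t - 1), p * q ^ (s - 1) *
        ∑' y : ℤ, ∑ l : Fin 2, W l n (x - y) s * Pdec p m l y (t - s))
      + q ^ (t - 1) * W m n x t := by
  subst hq
  obtain ⟨t, rfl⟩ := Nat.exists_eq_add_of_le' ht
  have hren := pathMass_renewal hp0.le hp1 m t 1 (x, n)
  have hfin := pathMass_ne_top hp0.le hp1 m t 1 (x, n)
  rw [hren, ENNReal.add_ne_top, ENNReal.sum_ne_top] at hfin
  rw [← toReal_pathMass_zero, pathMass_succ_zero hp0.le hp1, hren,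
    ENNReal.toReal_add (ENNReal.sum_ne_top.2 hfin.1) hfin.2, ENNReal.toReal_sum hfin.1,
    Nat.add_sub_cancel, ← Finset.Ico_add_one_right_eq_Icc, Finset.sum_Ico_eq_sum_range,
    Nat.add_sub_cancel]
  simp only [ENNReal.toReal_mul, ENNReal.toReal_pow, toReal_enorm, ENNReal.toReal_ofReal hp0.le,
    ENNReal.toReal_ofReal (sub_nonneg.2 hp1),
    toReal_tsum_ket_mul_pathMass hp0.le hp1, W, add_comm 1, Nat.add_sub_add_right,
    Nat.add_sub_cancel]

end
end

section
/- Let X_t be the symmetric decoherent Hadamard walk on the line with 0 < p ≤ 1 and q = 1 − p. Then for every integer t ≥ 0 the mean position vanishes: E(X_t) = Σ_{x∈ℤ} x·P(X_t = x) = 0. -/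
noncomputable section

open Complex Filter

/-- Spatial reflection `(x,n) ↦ (-x,1-n)` combined with a coin flip. -/
def flipSite : ℤ × Fin 2 ≃ ℤ × Fin 2 := (Equiv.neg ℤ).prodCongr (Equiv.swap 0 1)

@[simp] lemma flipSite_zero (x : ℤ) : flipSite (x, 0) = (-x, 1) := by simp [flipSite]

@[simp] lemma flipSite_one (x : ℤ) : flipSite (x, 1) = (-x, 0) := by simp [flipSite]

@[simp] lemma flipSite_flipSite (v : ℤ × Fin 2) : flipSite (flipSite v) = v := by
  obtain ⟨x, n⟩ := v
  simp [flipSite]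

/-- The alternating phase that makes the reflection commute with the Hadamard walk. -/
def flipPhase (v : ℤ × Fin 2) : ℂ := if v.2 = 0 then (-1) ^ v.1 else -(-1) ^ v.1

lemma norm_flipPhase (v : ℤ × Fin 2) : ‖flipPhase v‖ = 1 := by
  unfold flipPhase
  split_ifs <;> simp

/-- The reflection symmetry of the Hadamard walk, scaled by `c`. -/
def reflectState (c : ℂ) (ψ : QState) : QState := fun v => c * flipPhase v * ψ (flipSite v)

lemma hadamardStep_reflectState (c : ℂ) (ψ : QState) :
    hadamardStep (reflectState c ψ) = reflectState c (hadamardStep ψ) := by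
  funext ⟨x, n⟩
  have h : (-1 : ℂ) ≠ 0 := by norm_num
  fin_cases n
  · simp [hadamardStep, reflectState, flipPhase, zpow_sub_one₀ h, neg_add_eq_sub]
    ring
  · simp [hadamardStep, reflectState, flipPhase, zpow_add_one₀ h, neg_add', -neg_add_rev]
    ring

lemma measOp_reflectState (p : ℝ) (c : ℂ) (j : Option (ℤ × Fin 2)) (ψ : QState) :
    measOp p (j.map flipSite) (reflectState c ψ) = reflectState c (measOp p j ψ) := by
  funext v
  cases j with
  | none =>
    simp only [measOp, reflectState, Option.map_none]
    ring
  | some w =>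
    by_cases h : v = flipSite w
    · subst h
      simp only [measOp, reflectState, Option.map_some, flipSite_flipSite, if_true]
      ring
    · have h' : flipSite v ≠ w := fun e => h (by rw [← e, flipSite_flipSite])
      simp [measOp, reflectState, h, h']

lemma exists_ket_eq_reflectState (m : Fin 2) :
    ∃ c : ℂ, ‖c‖ = 1 ∧ ket 0 (Equiv.swap 0 1 m) = reflectState c (ket 0 m) := by
  fin_cases m
  · refine ⟨-1, by simp, ?_⟩
    funext ⟨x, n⟩
    fin_cases n <;> by_cases hx : x = 0 <;> simp [ket, reflectState, flipPhase, hx]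
  · refine ⟨1, by simp, ?_⟩
    funext ⟨x, n⟩
    fin_cases n <;> by_cases hx : x = 0 <;> simp [ket, reflectState, flipPhase, hx]

lemma pathAmp_map_flipSite (p : ℝ) (m : Fin 2) (c : ℂ)
    (hc : ket 0 (Equiv.swap 0 1 m) = reflectState c (ket 0 m)) (t : ℕ)
    (j : Fin t → Option (ℤ × Fin 2)) :
    pathAmp p (Equiv.swap 0 1 m) t (fun i => (j i).map flipSite) =
      reflectState c (pathAmp p m t j) := by
  induction t with
  | zero => exact hc
  | succ t ih =>
    simp only [pathAmp]
    rw [ih fun i => j i.castSucc, hadamardStep_reflectState, measOp_reflectState]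

lemma Pdec_swap_neg (p : ℝ) (m n : Fin 2) (x : ℤ) (t : ℕ) :
    Pdec p (Equiv.swap 0 1 m) (Equiv.swap 0 1 n) (-x) t = Pdec p m n x t := by
  obtain ⟨c, hc, hket⟩ := exists_ket_eq_reflectState m
  unfold Pdec
  rw [← (Equiv.piCongrRight fun _ : Fin t => Equiv.optionCongr flipSite).tsum_eq]
  refine tsum_congr fun j => ?_
  have h := congrFun (pathAmp_map_flipSite p m c hket t j) (flipSite (x, n))
  have hnorm : ‖pathAmp p (Equiv.swap 0 1 m) t (fun i => (j i).map flipSite)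
      (flipSite (x, n))‖ = ‖pathAmp p m t j (x, n)‖ := by
    rw [h, reflectState, flipSite_flipSite, norm_mul, norm_mul, hc, norm_flipPhase, one_mul,
      one_mul]
  exact congrArg (· ^ 2) hnorm

lemma PsymProb_neg (p : ℝ) (x : ℤ) (t : ℕ) : PsymProb p (-x) t = PsymProb p x t := by
  have h := fun m n => Pdec_swap_neg p m n x t
  have h00 := h 0 0
  have h01 := h 0 1
  have h10 := h 1 0
  have h11 := h 1 1
  simp only [Equiv.swap_apply_left, Equiv.swap_apply_right] at h00 h01 h10 h11
  simp only [PsymProb, Fin.sum_univ_two, h00, h01, h10, h11]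
  ring

/-- The symmetric decoherent Hadamard walk has mean zero at every time `t`. -/
theorem symmetric_walk_mean_zero (p q : ℝ) (hp0 : 0 < p) (hp1 : p ≤ 1) (hq : q = 1 - p)
    (t : ℕ) :
    ∑' x : ℤ, (x : ℝ) * PsymProb p x t = 0 := by
  have h := (Equiv.neg ℤ).tsum_eq fun x : ℤ => (x : ℝ) * PsymProb p x t
  simp only [Equiv.neg_apply, PsymProb_neg, Int.cast_neg, neg_mul, tsum_neg] at h
  linarith

end
end
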